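/- Let k be any field and n ≥ 3 an odd integer. Let G = D_n act on the rational function field k(x_1, …, x_{n−1}) by k-algebra automorphisms (acting trivially on k): σ(x_i) = x_{i+1} for 1 ≤ i ≤ n−2, σ(x_{n−1}) = (x_1 x_2 ⋯ x_{n−1})^{-1}, and τ(x_i) = x_{n−i} for 1 ≤ i ≤ n−1. Then the fixed field k(x_1, …, x_{n−1})^{D_n} is stably rational over k if and only if Noether's invariant field k(D_n) is stably rational over k. -/

import Mathlib

/-- A subfield of a rational function field that contains the constants and the variables is
everything. -/
theorem Subfield.eq_top_of_fractionRing_mvPolynomial {σ F : Type} [Field F]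
    (K : Subfield (FractionRing (MvPolynomial σ F)))
    (hC : ∀ a, algebraMap F _ a ∈ K)
    (hX : ∀ i, algebraMap (MvPolynomial σ F) _ (MvPolynomial.X i) ∈ K) : K = ⊤ := by
  have hp : ∀ p : MvPolynomial σ F, algebraMap _ (FractionRing (MvPolynomial σ F)) p ∈ K := by
    intro p
    induction p using MvPolynomial.induction_on with
    | C a => simpa [IsScalarTower.algebraMap_apply F (MvPolynomial σ F)] using hC a
    | add p q hp hq => simpa using K.add_mem hp hq
    | mul_X p i hp => simpa using K.mul_mem hp (hX i)
  rw [eq_top_iff]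
  rintro z -
  obtain ⟨a, b, -, rfl⟩ := IsFractionRing.div_surjective (A := MvPolynomial σ F) z
  exact K.div_mem (hp a) (hp b)

section Stable

variable {k : Type} [Field k]

theorem nonempty_algEquiv_fractionRing_sum (σ τ A : Type) [Field A] [Algebra k A] :
    Nonempty (FractionRing (MvPolynomial (σ ⊕ τ) A) ≃ₐ[k]
      FractionRing (MvPolynomial σ (FractionRing (MvPolynomial τ A)))) := by
  let P := FractionRing (MvPolynomial τ A)
  let E := FractionRing (MvPolynomial σ P)
  let x : τ → P := fun i => algebraMap (MvPolynomial τ A) P (MvPolynomial.X i)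
  let y : σ → E := fun i => algebraMap (MvPolynomial σ P) E (MvPolynomial.X i)
  have hx : AlgebraicIndependent A x :=
    (MvPolynomial.algebraicIndependent_X τ A).map' (f := IsScalarTower.toAlgHom A _ P)
      (IsFractionRing.injective (MvPolynomial τ A) P)
  have hy : AlgebraicIndependent P y :=
    (MvPolynomial.algebraicIndependent_X σ P).map' (f := IsScalarTower.toAlgHom P _ E)
      (IsFractionRing.injective (MvPolynomial σ P) E)
  have : IsScalarTower A P E := inferInstance
  have hxy := hx.sumElim_comp hy
  have htop : IntermediateField.adjoin A (Set.range (Sum.elim y (algebraMap P E ∘ x))) = ⊤ := by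
    set K := IntermediateField.adjoin A (Set.range (Sum.elim y (algebraMap P E ∘ x)))
    have hP : K.toSubfield.comap (algebraMap P E) = ⊤ := by
      apply Subfield.eq_top_of_fractionRing_mvPolynomial
      · intro a
        have := K.algebraMap_mem a
        rwa [IsScalarTower.algebraMap_apply A P E] at this
      · intro i
        exact IntermediateField.subset_adjoin _ _ ⟨Sum.inr i, rfl⟩
    have hE : K.toSubfield = ⊤ := by
      apply Subfield.eq_top_of_fractionRing_mvPolynomial
      · intro a
        have : a ∈ K.toSubfield.comap (algebraMap P E) := hP ▸ Subfield.mem_top a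
        exact this
      · intro i
        exact IntermediateField.subset_adjoin _ _ ⟨Sum.inl i, rfl⟩
    rw [eq_top_iff]
    intro z _
    have : z ∈ K.toSubfield := hE ▸ Subfield.mem_top z
    exact this
  exact ⟨((hxy.aevalEquivField.trans (IntermediateField.equivOfEq htop)).trans
    IntermediateField.topEquiv).restrictScalars k⟩

theorem nonempty_algEquiv_fractionRing_congr {σ τ A B : Type} [Field A] [Algebra k A] [Field B]
    [Algebra k B] (e : σ ≃ τ) (f : A ≃ₐ[k] B) :
    Nonempty (FractionRing (MvPolynomial σ A) ≃ₐ[k] FractionRing (MvPolynomial τ B)) :=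
  ⟨IsFractionRing.algEquivOfAlgEquiv
    ((MvPolynomial.mapAlgEquiv σ f).trans ((MvPolynomial.renameEquiv B e).restrictScalars k))⟩

/-- Stable rationality is unchanged by a purely transcendental extension. -/
theorem stably_rational_iff_of_algEquiv_fractionRing {ι A B : Type} [Finite ι] [Field A]
    [Algebra k A] [Field B] [Algebra k B] (e : FractionRing (MvPolynomial ι A) ≃ₐ[k] B) :
    (∃ r m : ℕ, Nonempty (FractionRing (MvPolynomial (Fin r) A) ≃ₐ[k]
        FractionRing (MvPolynomial (Fin m) k))) ↔
    (∃ r m : ℕ, Nonempty (FractionRing (MvPolynomial (Fin r) B) ≃ₐ[k]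
        FractionRing (MvPolynomial (Fin m) k))) := by
  obtain ⟨N, ⟨eN⟩⟩ := Finite.exists_equiv_fin ι
  constructor
  · rintro ⟨r, m, ⟨f⟩⟩
    obtain ⟨g1⟩ := nonempty_algEquiv_fractionRing_congr (Equiv.refl (Fin r)) e
    obtain ⟨g2⟩ := nonempty_algEquiv_fractionRing_sum (k := k) (Fin r) ι A
    obtain ⟨g3⟩ := nonempty_algEquiv_fractionRing_congr (k := k) (Equiv.sumComm ι (Fin r))
      (AlgEquiv.refl : A ≃ₐ[k] A)
    obtain ⟨g4⟩ := nonempty_algEquiv_fractionRing_sum (k := k) ι (Fin r) A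
    obtain ⟨g5⟩ := nonempty_algEquiv_fractionRing_congr (Equiv.refl ι) f
    obtain ⟨g6⟩ := nonempty_algEquiv_fractionRing_sum (k := k) ι (Fin m) k
    obtain ⟨g7⟩ := nonempty_algEquiv_fractionRing_congr (k := k)
      ((eN.sumCongr (Equiv.refl (Fin m))).trans finSumFinEquiv) (AlgEquiv.refl : k ≃ₐ[k] k)
    exact ⟨r, N + m, ⟨g1.symm.trans <| g2.symm.trans <| g3.symm.trans <| g4.trans <| g5.trans <|
      g6.symm.trans g7⟩⟩
  · rintro ⟨r, m, ⟨f⟩⟩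
    obtain ⟨g1⟩ := nonempty_algEquiv_fractionRing_congr (Equiv.refl (Fin r)) e
    obtain ⟨g2⟩ := nonempty_algEquiv_fractionRing_sum (k := k) (Fin r) ι A
    obtain ⟨g3⟩ := nonempty_algEquiv_fractionRing_congr (k := k)
      (((Equiv.refl (Fin r)).sumCongr eN).trans finSumFinEquiv) (AlgEquiv.refl : A ≃ₐ[k] A)
    exact ⟨r + N, m, ⟨g3.symm.trans <| g2.trans <| g1.trans f⟩⟩

end Stable

open scoped IntermediateField.algebraAdjoinAdjoin in
theorem Algebra.isAlgebraic_adjoin_of_intermediateField_adjoin_eq_top {F E : Type} [Field F]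
    [Field E] [Algebra F E] {s : Set E} (hs : IntermediateField.adjoin F s = ⊤) :
    Algebra.IsAlgebraic (Algebra.adjoin F s) E := by
  have : Algebra.IsAlgebraic (IntermediateField.adjoin F s) E := by
    refine ⟨fun z => ?_⟩
    have hz : z ∈ IntermediateField.adjoin F s := hs ▸ IntermediateField.mem_top
    exact isAlgebraic_algebraMap (⟨z, hz⟩ : IntermediateField.adjoin F s)
  exact (IsFractionRing.comap_isAlgebraic_iff (A := Algebra.adjoin F s)
    (K := IntermediateField.adjoin F s) (C := E)).mpr this

open Cardinal in
/-- A family that generates a field and has no more members than the transcendence degree is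
algebraically independent. -/
theorem AlgebraicIndependent.of_card_le_trdeg {κ F E : Type} [Field F] [Field E]
    [Algebra F E] [Finite κ] {y : κ → E} (hy : IntermediateField.adjoin F (Set.range y) = ⊤)
    (hcard : #κ ≤ Algebra.trdeg F E) : AlgebraicIndependent F y :=
  have := Algebra.isAlgebraic_adjoin_of_intermediateField_adjoin_eq_top hy
  (Algebra.IsAlgebraic.isTranscendenceBasis_of_le_trdeg_of_finite F y hcard).1

open Cardinal in
theorem AlgebraicIndependent.trdeg_eq_of_adjoin_eq_top {ι F E : Type} [Field F] [Field E]
    [Algebra F E] {x : ι → E} (hx : AlgebraicIndependent F x)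
    (hgen : IntermediateField.adjoin F (Set.range x) = ⊤) : Algebra.trdeg F E = #ι :=
  have := Algebra.isAlgebraic_adjoin_of_intermediateField_adjoin_eq_top hgen
  (hx.isTranscendenceBasis_iff_isAlgebraic.mpr this).cardinalMk_eq_trdeg.symm

section Descent

variable {G k L M : Type} [Group G] [Fintype G] [Field k] [Field L] [Field M] [Algebra k M]

/-- Galois descent: a subspace of `M` over a stable, faithfully acted upon field `L` is spanned by
its invariants. -/
theorem Submodule.le_span_invariants [Algebra L M] (ρ : G →* (M ≃ₐ[k] M))
    (hstable : ∀ g l, ∃ l', ρ g (algebraMap L M l) = algebraMap L M l')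
    (hfaithful : ∀ g, (∀ l, ρ g (algebraMap L M l) = algebraMap L M l) → g = 1)
    (W : Submodule L M) (hW : ∀ g, ∀ w ∈ W, ρ g w ∈ W) :
    W ≤ Submodule.span L {w | w ∈ W ∧ ∀ g, ρ g w = w} := by
  intro w hw
  by_contra hnot
  obtain ⟨φ, hφ, hker⟩ := Submodule.exists_le_ker_of_notMem hnot
  apply hφ
  choose a ha using hstable
  let χ : G → (L →* M) := fun g => ((ρ g : M →* M)).comp (algebraMap L M : L →* M)
  have hχ : ∀ g l, χ g l = algebraMap L M (a g l) := ha
  have hχinj : Function.Injective χ := by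
    intro g h hgh
    have : h⁻¹ * g = 1 := by
      apply hfaithful
      intro l
      have h1 : ρ g (algebraMap L M l) = ρ h (algebraMap L M l) := DFunLike.congr_fun hgh l
      rw [map_mul, AlgEquiv.mul_apply, h1, ← AlgEquiv.mul_apply, ← map_mul, inv_mul_cancel,
        map_one, AlgEquiv.one_apply]
    exact (inv_mul_eq_one.mp this).symm
  have hind := (linearIndependent_monoidHom L M).comp χ hχinj
  have hsum : ∑ g, algebraMap L M (φ (ρ g w)) • ((fun f : L →* M => (f : L → M)) ∘ χ) g = 0 := by
    funext θ
    have hinv : ∑ g, ρ g (θ • w) ∈ Submodule.span L {w | w ∈ W ∧ ∀ g, ρ g w = w} := by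
      refine Submodule.subset_span
        ⟨W.sum_mem fun g _ => hW g _ (W.smul_mem θ hw), fun h => ?_⟩
      rw [map_sum]
      simp_rw [← AlgEquiv.mul_apply, ← map_mul]
      exact Fintype.sum_bijective _ (Group.mulLeft_bijective h) _ _ fun g => rfl
    have h0 : φ (∑ g, ρ g (θ • w)) = 0 := hker hinv
    have h1 : ∀ g, ρ g (θ • w) = a g θ • ρ g w := fun g => by
      rw [Algebra.smul_def, Algebra.smul_def, map_mul, ha]
    simp_rw [h1, map_sum, map_smul] at h0
    have h2 := congrArg (algebraMap L M) h0
    rw [map_sum, map_zero] at h2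
    simp only [Finset.sum_apply, Pi.smul_apply, Function.comp_apply, Pi.zero_apply, hχ,
      smul_eq_mul]
    rw [← h2]
    exact Finset.sum_congr rfl fun g _ => by rw [smul_eq_mul, map_mul, mul_comm]
  have := Fintype.linearIndependent_iff.mp hind _ hsum 1
  rw [map_one, AlgEquiv.one_apply] at this
  exact (map_eq_zero _).mp this

theorem Submodule.map_mem_span [Algebra L M] (f : M ≃ₐ[k] M)
    (hstable : ∀ l, ∃ l', f (algebraMap L M l) = algebraMap L M l') {s : Set M}
    (hs : ∀ m ∈ s, f m ∈ Submodule.span L s) :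
    ∀ m ∈ Submodule.span L s, f m ∈ Submodule.span L s := by
  intro m hm
  induction hm using Submodule.span_induction with
  | mem x hx => exact hs x hx
  | zero => simp
  | add x y _ _ hx hy => rw [map_add]; exact Submodule.add_mem _ hx hy
  | smul l x _ hx =>
    obtain ⟨l', hl'⟩ := hstable l
    rw [Algebra.smul_def, map_mul, hl', ← Algebra.smul_def]
    exact Submodule.smul_mem _ _ hx

/-- A finite dimensional stable subspace of `M` is spanned by equally many invariants. -/
theorem exists_invariant_family [Algebra L M] (ρ : G →* (M ≃ₐ[k] M))
    (hstable : ∀ g l, ∃ l', ρ g (algebraMap L M l) = algebraMap L M l')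
    (hfaithful : ∀ g, (∀ l, ρ g (algebraMap L M l) = algebraMap L M l) → g = 1)
    {ι : Type} [Fintype ι] (q : ι → M)
    (hq : ∀ g, ∀ m ∈ Submodule.span L (Set.range q), ρ g m ∈ Submodule.span L (Set.range q)) :
    ∃ w : ι → M, (∀ g i, ρ g (w i) = w i) ∧ ∀ i, q i ∈ Submodule.span L (Set.range w) := by
  set W := Submodule.span L (Set.range q) with hWdef
  have hspan := W.le_span_invariants ρ hstable hfaithful hq
  obtain ⟨b, hb, hbspan, hbind⟩ := exists_linearIndependent L {w | w ∈ W ∧ ∀ g, ρ g w = w}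
  have hbW : LinearIndependent L (fun x : b => (⟨x, (hb x.2).1⟩ : W)) :=
    LinearIndependent.of_comp W.subtype hbind
  have : Module.Finite L W := Module.Finite.span_of_finite L (Set.finite_range q)
  have : Finite b := hbW.finite
  have := Fintype.ofFinite b
  have hcard : Fintype.card b ≤ Fintype.card ι :=
    hbW.fintype_card_le_finrank.trans (finrank_range_le_card q)
  obtain ⟨e⟩ := Function.Embedding.nonempty_of_card_le hcard
  refine ⟨Function.extend e Subtype.val 0, fun g i => ?_, fun i => ?_⟩
  · by_cases hi : ∃ j, e j = i
    · obtain ⟨j, rfl⟩ := hi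
      rw [e.injective.extend_apply]
      exact (hb j.2).2 g
    · rw [Function.extend_apply' _ _ _ hi]
      simp
  · have h1 : q i ∈ Submodule.span L b := hbspan ▸ hspan (Submodule.subset_span ⟨i, rfl⟩)
    refine Submodule.span_mono ?_ h1
    intro x hx
    exact ⟨e ⟨x, hx⟩, e.injective.extend_apply _ _ _⟩

theorem exists_sum_eq_one (ρ : G →* (M ≃ₐ[k] M)) (hρ : Function.Injective ρ) :
    ∃ θ : M, ∑ g, ρ g θ = 1 := by
  have hinj : Function.Injective (fun g => ((ρ g : M →* M))) := by
    intro g h hgh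
    exact hρ (AlgEquiv.ext fun x => DFunLike.congr_fun hgh x)
  have hind := (linearIndependent_monoidHom M M).comp _ hinj
  by_contra! hne
  have hzero : ∀ θ, ∑ g, ρ g θ = 0 := by
    intro θ
    by_contra h0
    set t := ∑ g, ρ g θ with ht
    have hinv : ∀ h, ρ h t = t := by
      intro h
      rw [ht, map_sum]
      simp_rw [← AlgEquiv.mul_apply, ← map_mul]
      exact Fintype.sum_bijective _ (Group.mulLeft_bijective h) _ _ fun g => rfl
    apply hne (t⁻¹ * θ)
    simp_rw [map_mul, map_inv₀, hinv]
    rw [← Finset.mul_sum, ← ht, inv_mul_cancel₀ h0]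
  have := Fintype.linearIndependent_iff.mp hind (fun _ => 1) (by
    funext θ
    simpa using hzero θ) 1
  exact one_ne_zero this

variable [Algebra k L] [Algebra L M] [IsScalarTower k L M]

/-- If `M` is generated over `L` by algebraically independent invariants, then its field of
invariants is the rational function field in these over the field of invariants of `L`. -/
theorem nonempty_algEquiv_fixedField (ρL : G →* (L ≃ₐ[k] L)) (ρM : G →* (M ≃ₐ[k] M))
    (hcompat : ∀ g l, ρM g (algebraMap L M l) = algebraMap L M (ρL g l))
    (hinj : Function.Injective ρM) {ι : Type} (w : ι → M)
    (hw : ∀ g i, ρM g (w i) = w i) (hind : AlgebraicIndependent L w)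
    (hgen : IntermediateField.adjoin L (Set.range w) = ⊤) :
    Nonempty (FractionRing (MvPolynomial ι (IntermediateField.fixedField ρL.range)) ≃ₐ[k]
      IntermediateField.fixedField ρM.range) := by
  set A := IntermediateField.fixedField ρL.range
  have hwA : AlgebraicIndependent A w := hind.restrictScalars (algebraMap A L).injective
  set K := IntermediateField.adjoin A (Set.range w) with hK
  have hfixK : ∀ g, ∀ m ∈ K, ρM g m = m := by
    intro g m hm
    induction hm using IntermediateField.adjoin_induction with
    | mem x hx => obtain ⟨i, rfl⟩ := hx; exact hw g i
    | algebraMap x =>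
      rw [IsScalarTower.algebraMap_apply A L M, hcompat]
      congr 1
      exact (IntermediateField.mem_fixedField_iff _ _).mp x.2 _ ⟨g, rfl⟩
    | add x y _ _ hx hy => rw [map_add, hx, hy]
    | inv x _ hx => rw [map_inv₀, hx]
    | mul x y _ _ hx hy => rw [map_mul, hx, hy]
  have hfin : Algebra.IsAlgebraic A L := by
    have : Finite ρL.range := Finite.of_surjective _ ρL.rangeRestrict_surjective
    have : Algebra.IsInvariant A L ρL.range := ⟨fun l hl =>
      ⟨⟨l, (IntermediateField.mem_fixedField_iff _ _).mpr fun f hf => hl ⟨f, hf⟩⟩, rfl⟩⟩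
    have := Algebra.IsInvariant.isIntegral A L ρL.range
    infer_instance
  have halgK : ∀ m ∈ Set.range (algebraMap L M), IsAlgebraic K m := by
    rintro _ ⟨l, rfl⟩
    have : IsAlgebraic A (algebraMap L M l) := (hfin.isAlgebraic l).algebraMap
    exact this.tower_top K
  have hadj : Algebra.adjoin K (Set.range (algebraMap L M)) = ⊤ := by
    rw [← IntermediateField.adjoin_toSubalgebra_of_isAlgebraic halgK]
    suffices IntermediateField.adjoin K (Set.range (algebraMap L M)) = ⊤ by
      rw [this]; rfl
    set T := IntermediateField.adjoin K (Set.range (algebraMap L M))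
    rw [eq_top_iff]
    intro m _
    have hm : m ∈ IntermediateField.adjoin L (Set.range w) := hgen ▸ IntermediateField.mem_top
    induction hm using IntermediateField.adjoin_induction with
    | mem x hx =>
      exact T.algebraMap_mem (⟨x, IntermediateField.subset_adjoin _ _ hx⟩ : K)
    | algebraMap x => exact IntermediateField.subset_adjoin _ _ ⟨x, rfl⟩
    | add x y _ _ hx hy => exact T.add_mem (hx trivial) (hy trivial)
    | inv x _ hx => exact T.inv_mem (hx trivial)
    | mul x y _ _ hx hy => exact T.mul_mem (hx trivial) (hy trivial)
  have htrace : ∀ m : M, ∑ g, ρM g m ∈ K := by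
    intro m
    have hclosure : Submonoid.closure (Set.range (algebraMap L M))
        = MonoidHom.mrange (algebraMap L M : L →* M) :=
      Submonoid.closure_eq (MonoidHom.mrange (algebraMap L M : L →* M))
    have hm : m ∈ Submodule.span K (Submonoid.closure (Set.range (algebraMap L M)) : Set M) := by
      rw [← Algebra.adjoin_eq_span, hadj]; trivial
    induction hm using Submodule.span_induction with
    | mem x hx =>
      rw [hclosure] at hx
      obtain ⟨l, rfl⟩ := hx
      have hl : ∑ g, ρL g l ∈ A := by
        rw [IntermediateField.mem_fixedField_iff]
        rintro _ ⟨h, rfl⟩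
        rw [map_sum]
        simp_rw [← AlgEquiv.mul_apply, ← map_mul]
        exact Fintype.sum_bijective _ (Group.mulLeft_bijective h) _ _ fun g => rfl
      have := K.algebraMap_mem ⟨_, hl⟩
      rw [IsScalarTower.algebraMap_apply A L M] at this
      change algebraMap L M (∑ g, ρL g l) ∈ K at this
      rw [map_sum] at this
      convert this using 2 with g
      exact hcompat g l
    | zero => simp
    | add x y _ _ hx hy =>
      simp_rw [map_add]
      rw [Finset.sum_add_distrib]
      exact K.add_mem hx hy
    | smul c x _ hx =>
      have : ∀ g, ρM g (c • x) = c * ρM g x := fun g => by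
        rw [Algebra.smul_def, map_mul]
        exact congrArg (· * _) (hfixK g c c.2)
      simp_rw [this]
      rw [← Finset.mul_sum]
      exact K.mul_mem c.2 hx
  have hKeq : K.restrictScalars k = IntermediateField.fixedField ρM.range := by
    ext m
    rw [IntermediateField.mem_restrictScalars, IntermediateField.mem_fixedField_iff]
    constructor
    · rintro hm _ ⟨g, rfl⟩
      exact hfixK g m hm
    · intro hm
      obtain ⟨θ, hθ⟩ := exists_sum_eq_one ρM hinj
      have h := htrace (θ * m)
      have h2 : ∀ g, ρM g (θ * m) = ρM g θ * m := fun g => by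
        rw [map_mul, hm _ ⟨g, rfl⟩]
      simp_rw [h2] at h
      rwa [← Finset.sum_mul, hθ, one_mul] at h
  have e1 : FractionRing (MvPolynomial ι A) ≃ₐ[k] K.restrictScalars k :=
    hwA.aevalEquivField.restrictScalars k
  exact ⟨e1.trans (IntermediateField.equivOfEq hKeq)⟩

end Descent

section Dihedral

open DihedralGroup

theorem DihedralGroup.generators_induction {n : ℕ} [NeZero n] {P : DihedralGroup n → Prop}
    (one : P 1) (mul : ∀ g h, P g → P h → P (g * h)) (rotation : P (r 1))
    (reflection : P (sr 0)) : ∀ g, P g := by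
  have hr : ∀ i : ZMod n, P (r i) := by
    intro i
    have hpow : ∀ j : ℕ, P (r 1 ^ j) := by
      intro j
      induction j with
      | zero => simpa using one
      | succ j ih => rw [pow_succ]; exact mul _ _ ih rotation
    simpa [r_one_pow] using hpow i.val
  intro g
  cases g with
  | r i => exact hr i
  | sr i => simpa using mul _ _ reflection (hr i)

variable {n : ℕ} {k M : Type} [Field k] [Field M] [Algebra k M]

/-- The quotient of the two variables in the coset of `r i` modulo the reflection `sr 0`. -/
noncomputable def cosetQuotient (x : DihedralGroup n → M) (i : ZMod n) : M :=
  x (r i) / x (sr (-i))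

/-- The inverse of `2` modulo an odd `n`. -/
def halfModOdd (n : ℕ) : ZMod n := ((n / 2 + 1 : ℕ) : ZMod n)

theorem halfModOdd_add_self (hodd : Odd n) : halfModOdd n + halfModOdd n = 1 := by
  obtain ⟨p, rfl⟩ := hodd
  have h : (2 * p + 1) / 2 + 1 + ((2 * p + 1) / 2 + 1) = (2 * p + 1) + 1 := by omega
  rw [halfModOdd, ← Nat.cast_add, h, Nat.cast_add, ZMod.natCast_self, zero_add, Nat.cast_one]

/-- Elements of `k(x_g : g ∈ D_n)` which the dihedral group permutes like the `v_i`. -/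
noncomputable def quotientRatio (x : DihedralGroup n → M) (i : ZMod n) : M :=
  cosetQuotient x (i + halfModOdd n) / cosetQuotient x (i - halfModOdd n)

section Ratios

variable {x : DihedralGroup n → M}

theorem cosetQuotient_ne_zero (hx : ∀ g, x g ≠ 0) (i : ZMod n) : cosetQuotient x i ≠ 0 :=
  div_ne_zero (hx _) (hx _)

theorem quotientRatio_ne_zero (hx : ∀ g, x g ≠ 0) (i : ZMod n) : quotientRatio x i ≠ 0 :=
  div_ne_zero (cosetQuotient_ne_zero hx _) (cosetQuotient_ne_zero hx _)

theorem variable_eq_cosetQuotient_mul (hx : ∀ g, x g ≠ 0) (i : ZMod n) :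
    x (r i) = cosetQuotient x i * x (sr (-i)) := by
  rw [cosetQuotient, div_mul_cancel₀ _ (hx _)]

theorem prod_quotientRatio [NeZero n] (hx : ∀ g, x g ≠ 0) :
    ∏ i : ZMod n, quotientRatio x i = 1 := by
  have h1 : ∏ i, cosetQuotient x (i + halfModOdd n) = ∏ i, cosetQuotient x i :=
    Fintype.prod_equiv (Equiv.addRight _) _ _ fun i => rfl
  have h2 : ∏ i, cosetQuotient x (i - halfModOdd n) = ∏ i, cosetQuotient x i :=
    Fintype.prod_equiv (Equiv.subRight _) _ _ fun i => rfl
  simp only [quotientRatio]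
  rw [Finset.prod_div_distrib, h1, h2]
  exact div_self (Finset.prod_ne_zero_iff.mpr fun i _ => cosetQuotient_ne_zero hx i)

theorem cosetQuotient_add_one (hodd : Odd n) (hx : ∀ g, x g ≠ 0) (i : ZMod n) :
    cosetQuotient x (i + 1) = quotientRatio x (i + halfModOdd n) * cosetQuotient x i := by
  rw [quotientRatio, add_assoc, halfModOdd_add_self hodd, add_sub_cancel_right,
    div_mul_cancel₀ _ (cosetQuotient_ne_zero hx i)]

/-- Up to a factor from a field containing the `quotientRatio x i`, all `cosetQuotient x i`
agree. -/
theorem exists_cosetQuotient_eq_mul [NeZero n] (hodd : Odd n) (hx : ∀ g, x g ≠ 0)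
    {S : Subfield M} (hS : ∀ i, quotientRatio x i ∈ S) (i : ZMod n) :
    ∃ c ∈ S, cosetQuotient x i = c * cosetQuotient x 0 := by
  have hnat : ∀ j : ℕ, ∃ c ∈ S, cosetQuotient x (j : ZMod n) = c * cosetQuotient x 0 := by
    intro j
    induction j with
    | zero => exact ⟨1, S.one_mem, by simp⟩
    | succ j ih =>
      obtain ⟨c, hc, h⟩ := ih
      refine ⟨quotientRatio x (j + halfModOdd n) * c, S.mul_mem (hS _) hc, ?_⟩
      rw [Nat.cast_succ, cosetQuotient_add_one hodd hx, h, mul_assoc]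
  simpa using hnat i.val

theorem quotientRatio_mem_of_ne_zero [NeZero n] (hx : ∀ g, x g ≠ 0) {S : Subfield M}
    (hS : ∀ i : ZMod n, i ≠ 0 → quotientRatio x i ∈ S) (i : ZMod n) : quotientRatio x i ∈ S := by
  by_cases hi : i = 0
  · subst hi
    have h := prod_quotientRatio hx
    rw [← Finset.mul_prod_erase _ _ (Finset.mem_univ (0 : ZMod n))] at h
    rw [eq_inv_of_mul_eq_one_left h]
    exact S.inv_mem (S.prod_mem fun j hj => hS j (Finset.ne_of_mem_erase hj))
  · exact hS i hi

/-- The `quotientRatio x i`, one `cosetQuotient` and half of the variables generate the field. -/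
theorem subfield_mem_variable [NeZero n] (hodd : Odd n) (hx : ∀ g, x g ≠ 0) {S : Subfield M}
    (hS : ∀ i : ZMod n, i ≠ 0 → quotientRatio x i ∈ S) (h0 : cosetQuotient x 0 ∈ S)
    (hsr : ∀ i, x (sr i) ∈ S) (g : DihedralGroup n) : x g ∈ S := by
  cases g with
  | sr i => exact hsr i
  | r i =>
    obtain ⟨c, hc, h⟩ := exists_cosetQuotient_eq_mul hodd hx (quotientRatio_mem_of_ne_zero hx hS) i
    rw [variable_eq_cosetQuotient_mul hx, h]
    exact S.mul_mem (S.mul_mem hc h0) (hsr _)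

variable {ρ : DihedralGroup n →* (M ≃ₐ[k] M)} (hρ : ∀ h g, ρ h (x g) = x (h * g))
include hρ

theorem rotation_cosetQuotient (i : ZMod n) :
    ρ (r 1) (cosetQuotient x i) = cosetQuotient x (i + 1) := by
  rw [cosetQuotient, map_div₀, hρ, hρ, r_mul_r, r_mul_sr, cosetQuotient, add_comm, neg_add,
    sub_eq_add_neg]

theorem reflection_cosetQuotient (i : ZMod n) :
    ρ (sr 0) (cosetQuotient x i) = (cosetQuotient x (-i))⁻¹ := by
  rw [cosetQuotient, map_div₀, hρ, hρ, sr_mul_r, sr_mul_sr, cosetQuotient, inv_div, neg_neg,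
    zero_add, sub_zero]

theorem rotation_quotientRatio (i : ZMod n) :
    ρ (r 1) (quotientRatio x i) = quotientRatio x (i + 1) := by
  rw [quotientRatio, map_div₀, rotation_cosetQuotient hρ, rotation_cosetQuotient hρ,
    quotientRatio, add_right_comm, sub_add_eq_add_sub]

theorem reflection_quotientRatio (i : ZMod n) :
    ρ (sr 0) (quotientRatio x i) = quotientRatio x (-i) := by
  rw [quotientRatio, map_div₀, reflection_cosetQuotient hρ, reflection_cosetQuotient hρ,
    quotientRatio, inv_div_inv, neg_sub', neg_add', sub_neg_eq_add]

theorem rotation_quotientRatio_general [NeZero n] (j i : ZMod n) :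
    ρ (r j) (quotientRatio x i) = quotientRatio x (i + j) := by
  have hnat : ∀ m : ℕ, ρ (r (m : ZMod n)) (quotientRatio x i) = quotientRatio x (i + m) := by
    intro m
    induction m with
    | zero => rw [Nat.cast_zero, add_zero, ← one_def, map_one, AlgEquiv.one_apply]
    | succ m ih =>
      rw [Nat.cast_succ, add_comm, ← r_mul_r, map_mul, AlgEquiv.mul_apply, ih,
        rotation_quotientRatio hρ, add_assoc, add_comm (m : ZMod n)]
  simpa using hnat j.val

end Ratios

open Cardinal in
theorem algebraicIndependent_quotientRatio [NeZero n] (hodd : Odd n) {x : DihedralGroup n → M}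
    (hind : AlgebraicIndependent k x)
    (hgen : IntermediateField.adjoin k (Set.range x) = ⊤) :
    AlgebraicIndependent k (fun i : {i : ZMod n // i ≠ 0} => quotientRatio x i) := by
  have hx : ∀ g, x g ≠ 0 := hind.ne_zero
  let y : {i : ZMod n // i ≠ 0} ⊕ (Unit ⊕ ZMod n) → M :=
    Sum.elim (fun i => quotientRatio x i) (Sum.elim (fun _ => cosetQuotient x 0) fun i => x (sr i))
  have hy : IntermediateField.adjoin k (Set.range y) = ⊤ := by
    rw [eq_top_iff, ← hgen, IntermediateField.adjoin_le_iff]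
    rintro _ ⟨g, rfl⟩
    have hmem : ∀ i, y i ∈ IntermediateField.adjoin k (Set.range y) := fun i =>
      IntermediateField.subset_adjoin _ _ ⟨i, rfl⟩
    exact subfield_mem_variable hodd hx (S := (IntermediateField.adjoin k (Set.range y)).toSubfield)
      (fun i hi => hmem (Sum.inl ⟨i, hi⟩)) (hmem (Sum.inr (Sum.inl ())))
      (fun i => hmem (Sum.inr (Sum.inr i))) g
  have hyind : AlgebraicIndependent k y := by
    apply AlgebraicIndependent.of_card_le_trdeg hy
    rw [hind.trdeg_eq_of_adjoin_eq_top hgen, ← Nat.cast_card, ← Nat.cast_card]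
    have h1 : Nat.card {i : ZMod n // i ≠ 0} = n - 1 := by
      rw [Nat.card_eq_fintype_card, Fintype.card_subtype_compl, ZMod.card]
      simp
    have hn : n ≠ 0 := NeZero.ne n
    rw [Nat.card_sum, Nat.card_sum, h1, DihedralGroup.nat_card, Nat.card_zmod, Nat.card_unique]
    exact_mod_cast (by omega)
  exact hyind.comp Sum.inl Sum.inl_injective

theorem quotientRatio_injective [NeZero n] (hn : 3 ≤ n) (hodd : Odd n) {x : DihedralGroup n → M}
    (hind : AlgebraicIndependent k x)
    (hgen : IntermediateField.adjoin k (Set.range x) = ⊤)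
    {ρ : DihedralGroup n →* (M ≃ₐ[k] M)} (hρ : ∀ h g, ρ h (x g) = x (h * g)) :
    Function.Injective (quotientRatio x) := by
  intro i j hij
  obtain ⟨l, hl⟩ : ∃ l : ZMod n, l ∉ ({i, j} : Finset (ZMod n)) := by
    by_contra! h
    have h1 := Finset.card_le_two (a := i) (b := j)
    rw [Finset.eq_univ_iff_forall.mpr h, Finset.card_univ, ZMod.card] at h1
    omega
  simp only [Finset.mem_insert, Finset.mem_singleton, not_or] at hl
  have hinj := (algebraicIndependent_quotientRatio hodd hind hgen).injective
  have h := congrArg (ρ (r (-l))) hij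
  rw [rotation_quotientRatio_general hρ, rotation_quotientRatio_general hρ, ← sub_eq_add_neg,
    ← sub_eq_add_neg] at h
  have := @hinj ⟨i - l, sub_ne_zero.mpr (Ne.symm hl.1)⟩ ⟨j - l, sub_ne_zero.mpr (Ne.symm hl.2)⟩ h
  exact sub_left_injective (Subtype.ext_iff.mp this)

theorem eq_one_of_fixes_quotientRatio [NeZero n] (hn : 3 ≤ n) (hodd : Odd n)
    {x : DihedralGroup n → M} (hind : AlgebraicIndependent k x)
    (hgen : IntermediateField.adjoin k (Set.range x) = ⊤)
    {ρ : DihedralGroup n →* (M ≃ₐ[k] M)} (hρ : ∀ h g, ρ h (x g) = x (h * g))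
    (g : DihedralGroup n) (hg : ∀ i, ρ g (quotientRatio x i) = quotientRatio x i) : g = 1 := by
  have hinj := quotientRatio_injective hn hodd hind hgen hρ
  cases g with
  | r j =>
    have := hg 0
    rw [rotation_quotientRatio_general hρ, zero_add] at this
    rw [hinj this, one_def]
  | sr j =>
    have key : ∀ i : ZMod n, -(i + j) = i := by
      intro i
      apply hinj
      rw [← hg i, ← zero_add j, ← sr_mul_r, map_mul, AlgEquiv.mul_apply,
        rotation_quotientRatio_general hρ, reflection_quotientRatio hρ, zero_add]
    have h0 := key 0
    have h1 := key 1
    rw [zero_add, neg_eq_zero] at h0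
    rw [h0, add_zero] at h1
    have h2 : ((2 : ℕ) : ZMod n) = 0 := by
      push_cast
      linear_combination -h1
    rw [ZMod.natCast_eq_zero_iff] at h2
    exact absurd (Nat.le_of_dvd two_pos h2) (by omega)

end Dihedral

section Comparison

open DihedralGroup

variable {n : ℕ} [NeZero n] {k L M : Type} [Field k] [Field L] [Field M] [Algebra k L] [Algebra k M]

/-- A field generated by algebraically independent elements `v i` maps to any field with equally
many algebraically independent elements `y i`, by `v i ↦ y i`. -/
theorem AlgebraicIndependent.exists_algHom_of_adjoin_eq_top {ι : Type} {v : ι → L} {y : ι → M}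
    (hv : AlgebraicIndependent k v) (hgen : IntermediateField.adjoin k (Set.range v) = ⊤)
    (hy : AlgebraicIndependent k y) : ∃ φ : L →ₐ[k] M, ∀ i, φ (v i) = y i := by
  refine ⟨(IntermediateField.val _).comp (hy.aevalEquivField.toAlgHom.comp
    (hv.aevalEquivField.symm.toAlgHom.comp ((IntermediateField.equivOfEq hgen.symm).toAlgHom.comp
      IntermediateField.topEquiv.symm.toAlgHom))), fun i => ?_⟩
  have h1 : hv.aevalEquivField.symm ⟨v i, IntermediateField.subset_adjoin _ _ ⟨i, rfl⟩⟩
      = algebraMap (MvPolynomial ι k) (FractionRing (MvPolynomial ι k)) (MvPolynomial.X i) := by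
    rw [AlgEquiv.symm_apply_eq]
    apply Subtype.ext
    rw [aevalEquivField_algebraMap_apply_coe, MvPolynomial.aeval_X]
  have h2 := hy.aevalEquivField_algebraMap_apply_coe (MvPolynomial.X i)
  rw [MvPolynomial.aeval_X, ← h1] at h2
  exact h2

theorem AlgHom.ext_of_intermediateField_adjoin_eq_top {s : Set L}
    (hs : IntermediateField.adjoin k s = ⊤) {f g : L →ₐ[k] M} (h : ∀ a ∈ s, f a = g a) :
    f = g := by
  ext a
  have ha : a ∈ IntermediateField.adjoin k s := hs ▸ IntermediateField.mem_top
  induction ha using IntermediateField.adjoin_induction with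
  | mem a ha => exact h a ha
  | algebraMap a => rw [f.commutes, g.commutes]
  | add a b _ _ ha hb => rw [map_add, map_add, ha, hb]
  | inv a _ ha => rw [map_inv₀, map_inv₀, ha]
  | mul a b _ _ ha hb => rw [map_mul, map_mul, ha, hb]

variable {x : DihedralGroup n → M} {ρ : DihedralGroup n →* (M ≃ₐ[k] M)}

theorem exists_equivariant_algHom (hodd : Odd n) {v : ZMod n → L} (hprod : ∏ i, v i = 1)
    (hindv : AlgebraicIndependent k (fun i : {i : ZMod n // i ≠ 0} => v i))
    (hgenv : IntermediateField.adjoin k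
      (Set.range (fun i : {i : ZMod n // i ≠ 0} => v i)) = ⊤)
    {ρL : DihedralGroup n →* (L ≃ₐ[k] L)} (hσ : ∀ i, ρL (r 1) (v i) = v (i + 1))
    (hτ : ∀ i, ρL (sr 0) (v i) = v (-i)) (hind : AlgebraicIndependent k x)
    (hgen : IntermediateField.adjoin k (Set.range x) = ⊤) (hρ : ∀ h g, ρ h (x g) = x (h * g)) :
    ∃ φ : L →ₐ[k] M, (∀ i, φ (v i) = quotientRatio x i) ∧
      ∀ g l, ρ g (φ l) = φ (ρL g l) := by
  obtain ⟨φ, hφ⟩ := hindv.exists_algHom_of_adjoin_eq_top hgenv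
    (algebraicIndependent_quotientRatio hodd hind hgen)
  have hφ' : ∀ i, φ (v i) = quotientRatio x i := by
    intro i
    by_cases hi : i = 0
    · subst hi
      have h1 := congrArg φ hprod
      rw [map_prod, map_one, ← prod_quotientRatio hind.ne_zero,
        ← Finset.mul_prod_erase _ _ (Finset.mem_univ (0 : ZMod n)),
        ← Finset.mul_prod_erase _ _ (Finset.mem_univ (0 : ZMod n)),
        Finset.prod_congr rfl fun j hj => hφ ⟨j, Finset.ne_of_mem_erase hj⟩] at h1
      exact mul_right_cancel₀
        (Finset.prod_ne_zero_iff.mpr fun j _ => quotientRatio_ne_zero hind.ne_zero j) h1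
    · exact hφ ⟨i, hi⟩
  refine ⟨φ, hφ', DihedralGroup.generators_induction ?_ ?_ ?_ ?_⟩
  · simp
  · intro g h hg hh l
    rw [map_mul, map_mul, AlgEquiv.mul_apply, AlgEquiv.mul_apply, hh, hg]
  · refine DFunLike.congr_fun (f := (ρ (r 1)).toAlgHom.comp φ)
      (g := φ.comp (ρL (r 1)).toAlgHom)
      (AlgHom.ext_of_intermediateField_adjoin_eq_top hgenv ?_)
    rintro _ ⟨i, rfl⟩
    change ρ (r 1) (φ (v i)) = φ (ρL (r 1) (v i))
    rw [hφ', hσ, hφ', rotation_quotientRatio hρ]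
  · refine DFunLike.congr_fun (f := (ρ (sr 0)).toAlgHom.comp φ)
      (g := φ.comp (ρL (sr 0)).toAlgHom)
      (AlgHom.ext_of_intermediateField_adjoin_eq_top hgenv ?_)
    rintro _ ⟨i, rfl⟩
    change ρ (sr 0) (φ (v i)) = φ (ρL (sr 0) (v i))
    rw [hφ', hτ, hφ', reflection_quotientRatio hρ]

theorem map_mem_span_of_generators {E : Type} [Field E] [Algebra E M]
    (hstable : ∀ g l, ∃ l', ρ g (algebraMap E M l) = algebraMap E M l') {s : Set M}
    (hσ : ∀ m ∈ s, ρ (r 1) m ∈ Submodule.span E s)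
    (hτ : ∀ m ∈ s, ρ (sr 0) m ∈ Submodule.span E s) :
    ∀ g, ∀ m ∈ Submodule.span E s, ρ g m ∈ Submodule.span E s := by
  refine DihedralGroup.generators_induction ?_ ?_ ?_ ?_
  · simp
  · intro g h hg hh m hm
    rw [map_mul, AlgEquiv.mul_apply]
    exact hg _ (hh m hm)
  · exact Submodule.map_mem_span _ (hstable _) hσ
  · exact Submodule.map_mem_span _ (hstable _) hτ

omit [Algebra k L] in
/-- Adjoining `cosetQuotient x 0` to a field containing the `quotientRatio x i` can be done by
adjoining an invariant instead. -/
theorem exists_invariant_cosetQuotient_mem_adjoin [Algebra L M] (hodd : Odd n)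
    (hx : ∀ g, x g ≠ 0) (hρ : ∀ h g, ρ h (x g) = x (h * g))
    (hstable : ∀ g l, ∃ l', ρ g (algebraMap L M l) = algebraMap L M l')
    (hfaithful : ∀ g, (∀ l, ρ g (algebraMap L M l) = algebraMap L M l) → g = 1)
    (hratio : ∀ i, quotientRatio x i ∈ (algebraMap L M).fieldRange) :
    ∃ z : M, (∀ g, ρ g z = z) ∧ cosetQuotient x 0 ∈ IntermediateField.adjoin L {z} := by
  obtain ⟨p, hp⟩ := id hodd
  set d := cosetQuotient x 0 with hd
  have hd0 : d ≠ 0 := cosetQuotient_ne_zero hx 0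
  set P := ∏ i : ZMod n, x (sr i) with hP
  have hP0 : P ≠ 0 := Finset.prod_ne_zero_iff.mpr fun i _ => hx _
  have hσP : ρ (r 1) P = P := by
    rw [hP, map_prod]
    exact Fintype.prod_equiv (Equiv.subRight (1 : ZMod n)) _ _ fun i => by
      rw [hρ, r_mul_sr]; rfl
  have hσd : ∃ e, ρ (r 1) d = algebraMap L M e * d := by
    obtain ⟨e, he⟩ := hratio (0 + halfModOdd n)
    exact ⟨e, by rw [hd, rotation_cosetQuotient hρ, cosetQuotient_add_one hodd hx, he]⟩
  have hτd : ρ (sr 0) d = d⁻¹ := by rw [hd, reflection_cosetQuotient hρ, neg_zero]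
  have hτP : ∃ c, ρ (sr 0) P = algebraMap L M c * (d ^ n * P) := by
    choose c hc hcd using exists_cosetQuotient_eq_mul hodd hx hratio
    obtain ⟨c', hc'⟩ := Subfield.prod_mem (algebraMap L M).fieldRange (t := Finset.univ)
      (f := c) fun i _ => hc i
    refine ⟨c', ?_⟩
    have h1 : ∏ i : ZMod n, x (sr (-i)) = P := Fintype.prod_equiv (Equiv.neg _) _ _ fun i => rfl
    have h2 : ρ (sr 0) P = ∏ i : ZMod n, x (r i) := by
      rw [hP, map_prod]
      exact Finset.prod_congr rfl fun i _ => by rw [hρ, sr_mul_sr, sub_zero]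
    rw [h2, Finset.prod_congr rfl fun i _ => variable_eq_cosetQuotient_mul hx i,
      Finset.prod_mul_distrib, h1, Finset.prod_congr rfl fun i _ => hcd i,
      Finset.prod_mul_distrib, hc', Finset.prod_const, Finset.card_univ, ZMod.card, mul_assoc]
  obtain ⟨e, hσd⟩ := hσd
  obtain ⟨c, hτP⟩ := hτP
  let q : Fin 2 → M := ![P * d ^ (p + 1), P * d ^ p]
  have hspan : ∀ (i : Fin 2) (l : L) (m : M), m = algebraMap L M l * q i →
      m ∈ Submodule.span L (Set.range q) := by
    rintro i l m rfl
    rw [← Algebra.smul_def]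
    exact Submodule.smul_mem _ _ (Submodule.subset_span ⟨i, rfl⟩)
  have hq : ∀ g, ∀ m ∈ Submodule.span L (Set.range q), ρ g m ∈ Submodule.span L (Set.range q) := by
    apply map_mem_span_of_generators hstable
    · rintro _ ⟨i, rfl⟩
      fin_cases i
      · apply hspan 0 (e ^ (p + 1))
        change ρ (r 1) (P * d ^ (p + 1)) = _ * (P * d ^ (p + 1))
        rw [map_mul, map_pow, map_pow, hσP, hσd]
        ring
      · apply hspan 1 (e ^ p)
        change ρ (r 1) (P * d ^ p) = _ * (P * d ^ p)
        rw [map_mul, map_pow, map_pow, hσP, hσd]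
        ring
    · rintro _ ⟨i, rfl⟩
      fin_cases i
      · apply hspan 1 c
        change ρ (sr 0) (P * d ^ (p + 1)) = _ * (P * d ^ p)
        rw [map_mul, map_pow, hτP, hτd, hp, inv_pow]
        field_simp
        ring
      · apply hspan 0 c
        change ρ (sr 0) (P * d ^ p) = _ * (P * d ^ (p + 1))
        rw [map_mul, map_pow, hτP, hτd, hp, inv_pow]
        field_simp
        ring
  obtain ⟨w, hw, hqw⟩ := exists_invariant_family ρ hstable hfaithful q hq
  refine ⟨w 0 / w 1, fun g => by rw [map_div₀, hw, hw], ?_⟩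
  set F := IntermediateField.adjoin L {w 0 / w 1}
  have hz : w 0 / w 1 ∈ F := IntermediateField.subset_adjoin _ _ rfl
  have hdq : d = q 0 / q 1 := by
    change d = P * d ^ (p + 1) / (P * d ^ p)
    rw [pow_succ]
    field_simp
  obtain ⟨u, hu⟩ : ∃ u, ∀ i, ∃ f ∈ F, q i = f * u := by
    have hcomb : ∀ i, ∃ a b, q i = algebraMap L M a * w 0 + algebraMap L M b * w 1 := by
      intro i
      obtain ⟨a, ha⟩ := Submodule.mem_span_range_iff_exists_fun L |>.mp (hqw i)
      rw [Fin.sum_univ_two, Algebra.smul_def, Algebra.smul_def] at ha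
      exact ⟨_, _, ha.symm⟩
    by_cases h : w 1 = 0
    · refine ⟨w 0, fun i => ?_⟩
      obtain ⟨a, b, hab⟩ := hcomb i
      exact ⟨_, F.algebraMap_mem a, by rw [hab, h, mul_zero, add_zero]⟩
    · refine ⟨w 1, fun i => ?_⟩
      obtain ⟨a, b, hab⟩ := hcomb i
      exact ⟨_, F.add_mem (F.mul_mem (F.algebraMap_mem a) hz) (F.algebraMap_mem b), by
        rw [hab]; field_simp⟩
  obtain ⟨f, hf, hqf⟩ := hu 0
  obtain ⟨f', hf', hqf'⟩ := hu 1
  rw [hdq, hqf, hqf', mul_div_mul_right]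
  · exact F.div_mem hf hf'
  · intro h
    rw [h, mul_zero] at hqf'
    exact mul_ne_zero hP0 (pow_ne_zero p hd0) hqf'

/-- The variables indexed by reflections are linear combinations of invariants, with coefficients
in the field of the coset quotients. -/
theorem exists_invariant_variable_mem_span (hn : 3 ≤ n) (hodd : Odd n)
    (hind : AlgebraicIndependent k x)
    (hgen : IntermediateField.adjoin k (Set.range x) = ⊤) (hρ : ∀ h g, ρ h (x g) = x (h * g)) :
    ∃ w : ZMod n → M, (∀ g i, ρ g (w i) = w i) ∧ ∀ i, x (sr i) ∈
      Submodule.span (IntermediateField.adjoin k (Set.range (cosetQuotient x)))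
        (Set.range w) := by
  set T := IntermediateField.adjoin k (Set.range (cosetQuotient x))
  have hdT : ∀ i, cosetQuotient x i ∈ T := fun i => IntermediateField.subset_adjoin _ _ ⟨i, rfl⟩
  have hT : ∀ f : M ≃ₐ[k] M, (∀ i, f (cosetQuotient x i) ∈ T) → ∀ m ∈ T, f m ∈ T := by
    intro f hf
    have : T ≤ T.comap f.toAlgHom := IntermediateField.adjoin_le_iff.mpr (by
      rintro _ ⟨i, rfl⟩
      exact hf i)
    exact this
  have hstable : ∀ g, ∀ m ∈ T, ρ g m ∈ T := by
    refine DihedralGroup.generators_induction ?_ ?_ ?_ ?_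
    · simp
    · intro g h hg hh m hm
      rw [map_mul, AlgEquiv.mul_apply]
      exact hg _ (hh m hm)
    · exact hT _ fun i => rotation_cosetQuotient hρ i ▸ hdT _
    · exact hT _ fun i => reflection_cosetQuotient hρ i ▸ T.inv_mem (hdT _)
  have hstable' : ∀ g (l : T), ∃ l' : T, ρ g (algebraMap T M l) = algebraMap T M l' :=
    fun g l => ⟨⟨_, hstable g l l.2⟩, rfl⟩
  refine exists_invariant_family ρ hstable' (fun g hg => ?_) (fun i => x (sr i))
    (map_mem_span_of_generators hstable' ?_ ?_)
  · exact eq_one_of_fixes_quotientRatio hn hodd hind hgen hρ g fun i =>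
      hg ⟨quotientRatio x i, T.div_mem (hdT _) (hdT _)⟩
  · rintro _ ⟨i, rfl⟩
    rw [hρ, r_mul_sr]
    exact Submodule.subset_span ⟨_, rfl⟩
  · rintro _ ⟨i, rfl⟩
    rw [hρ, sr_mul_sr, variable_eq_cosetQuotient_mul hind.ne_zero]
    exact Submodule.smul_mem _ (⟨_, hdT _⟩ : T) (Submodule.subset_span ⟨_, rfl⟩)

open Cardinal in
/-- Over the field generated by the `quotientRatio x i`, the field `M` is rational with invariant
generators. -/
theorem exists_invariant_generators [Algebra L M] [IsScalarTower k L M] (hn : 3 ≤ n)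
    (hodd : Odd n) {v : ZMod n → L}
    (hindv : AlgebraicIndependent k (fun i : {i : ZMod n // i ≠ 0} => v i))
    (hgenv : IntermediateField.adjoin k
      (Set.range (fun i : {i : ZMod n // i ≠ 0} => v i)) = ⊤)
    {ρL : DihedralGroup n →* (L ≃ₐ[k] L)} (hind : AlgebraicIndependent k x)
    (hgen : IntermediateField.adjoin k (Set.range x) = ⊤) (hρ : ∀ h g, ρ h (x g) = x (h * g))
    (hv : ∀ i, algebraMap L M (v i) = quotientRatio x i)
    (hcompat : ∀ g l, ρ g (algebraMap L M l) = algebraMap L M (ρL g l)) :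
    ∃ w : Unit ⊕ ZMod n → M, (∀ g i, ρ g (w i) = w i) ∧ AlgebraicIndependent L w ∧
      IntermediateField.adjoin L (Set.range w) = ⊤ := by
  have hx : ∀ g, x g ≠ 0 := hind.ne_zero
  obtain ⟨z, hz, hdz⟩ := exists_invariant_cosetQuotient_mem_adjoin (L := L) hodd hx hρ
    (fun g l => ⟨_, hcompat g l⟩)
    (fun g hg => eq_one_of_fixes_quotientRatio hn hodd hind hgen hρ g fun i =>
      hv i ▸ hg (v i)) fun i => ⟨_, hv i⟩
  obtain ⟨w, hw, hxw⟩ := exists_invariant_variable_mem_span hn hodd hind hgen hρ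
  let W : Unit ⊕ ZMod n → M := Sum.elim (fun _ => z) w
  have hgenW : IntermediateField.adjoin L (Set.range W) = ⊤ := by
    set F := IntermediateField.adjoin L (Set.range W)
    have hratio : ∀ i, quotientRatio x i ∈ F := fun i => hv i ▸ F.algebraMap_mem (v i)
    have hd : cosetQuotient x 0 ∈ F :=
      IntermediateField.adjoin.mono L _ _
        (Set.singleton_subset_iff.mpr (Set.mem_range_self (f := W) (Sum.inl ()))) hdz
    have hT : IntermediateField.adjoin k (Set.range (cosetQuotient x))
        ≤ F.restrictScalars k := by
      rw [IntermediateField.adjoin_le_iff]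
      rintro _ ⟨i, rfl⟩
      obtain ⟨c, hc, h⟩ := exists_cosetQuotient_eq_mul hodd hx (S := F.toSubfield) hratio i
      rw [h]
      exact F.mul_mem hc hd
    have hsr : ∀ i, x (sr i) ∈ F := by
      intro i
      obtain ⟨a, ha⟩ := Submodule.mem_span_range_iff_exists_fun _ |>.mp (hxw i)
      rw [← ha]
      exact F.sum_mem fun j _ => F.mul_mem (hT (a j).2)
        (IntermediateField.subset_adjoin _ _ ⟨Sum.inr j, rfl⟩)
    have hall : (⊤ : IntermediateField k M) ≤ F.restrictScalars k := by
      rw [← hgen, IntermediateField.adjoin_le_iff]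
      rintro _ ⟨g, rfl⟩
      exact subfield_mem_variable hodd hx (S := F.toSubfield) (fun i _ => hratio i) hd hsr g
    exact eq_top_iff.mpr fun m _ => hall IntermediateField.mem_top
  refine ⟨W, fun g i => ?_, AlgebraicIndependent.of_card_le_trdeg hgenW ?_, hgenW⟩
  · cases i with
    | inl _ => exact hz g
    | inr i => exact hw g i
  · have htr := trdeg_add_eq k L (A := M)
    rw [hindv.trdeg_eq_of_adjoin_eq_top hgenv, hind.trdeg_eq_of_adjoin_eq_top hgen,
      ← Nat.cast_card, ← Nat.cast_card] at htr
    have h1 : Nat.card {i : ZMod n // i ≠ 0} = n - 1 := by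
      rw [Nat.card_eq_fintype_card, Fintype.card_subtype_compl, ZMod.card]
      simp
    rw [h1, DihedralGroup.nat_card] at htr
    rw [← Nat.cast_card, Nat.card_sum, Nat.card_zmod, Nat.card_unique]
    by_contra! hlt
    obtain ⟨t, ht⟩ := Cardinal.lt_aleph0.mp (hlt.trans Cardinal.natCast_lt_aleph0)
    rw [ht] at htr hlt
    norm_cast at htr hlt
    omega

end Comparison

/-- let `k` be any field and `n ≥ 3` odd.  Let `D_n` act on the
rational function field `L = k(x_1, …, x_{n-1})` by `k`-algebra automorphisms
(trivially on `k`): `σ : x_i ↦ x_{i+1}` (`1 ≤ i ≤ n-2`),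
`x_{n-1} ↦ (x_1⋯x_{n-1})⁻¹`, and `τ : x_i ↦ x_{n-i}`.

This purely monomial action is encoded by a family `v : ZMod n → L` with
`∏ v_i = 1` (so `v_0 = (v_1⋯v_{n-1})⁻¹`), where the `v_i` with `i ≠ 0` are
algebraically independent over `k` and generate `L` as a field over `k`, and
`σ(v_i) = v_{i+1}`, `τ(v_i) = v_{-i}` for all `i ∈ ZMod n`.

Let `k(D_n)` be Noether's invariant field: the fixed field of the permutation
action `h • x_g = x_{hg}` of `D_n` on `k(x_g : g ∈ D_n)`.  Then `L^{D_n}` is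
stably rational over `k` if and only if `k(D_n)` is stably rational over `k`. -/
theorem purely_monomial_stably_rational_iff_noether (n : ℕ) (hn : 3 ≤ n)
    (hodd : Odd n) [NeZero n]
    (k : Type) [Field k]
    -- the function field k(x_1, …, x_{n-1}) with the purely monomial action
    (L : Type) [Field L] [Algebra k L]
    (v : ZMod n → L)
    (hprod : ∏ i : ZMod n, v i = 1)
    (hind : AlgebraicIndependent k (fun i : {i : ZMod n // i ≠ 0} => v i))
    (hgen : IntermediateField.adjoin k
      (Set.range (fun i : {i : ZMod n // i ≠ 0} => v i)) = ⊤)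
    (ρ : DihedralGroup n →* (L ≃ₐ[k] L))
    (hσ : ∀ i : ZMod n, ρ (DihedralGroup.r 1) (v i) = v (i + 1))
    (hτ : ∀ i : ZMod n, ρ (DihedralGroup.sr 0) (v i) = v (-i))
    -- Noether's setting: k(x_g : g ∈ D_n) with the regular permutation action
    (L' : Type) [Field L'] [Algebra k L']
    (x : DihedralGroup n → L')
    (hind' : AlgebraicIndependent k x)
    (hgen' : IntermediateField.adjoin k (Set.range x) = ⊤)
    (ρ' : DihedralGroup n →* (L' ≃ₐ[k] L'))
    (hρ' : ∀ h g : DihedralGroup n, ρ' h (x g) = x (h * g)) :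
    (∃ (r m : ℕ),
      Nonempty ((FractionRing (MvPolynomial (Fin r)
          ↥(IntermediateField.fixedField ρ.range))) ≃ₐ[k]
        FractionRing (MvPolynomial (Fin m) k))) ↔
    (∃ (r m : ℕ),
      Nonempty ((FractionRing (MvPolynomial (Fin r)
          ↥(IntermediateField.fixedField ρ'.range))) ≃ₐ[k]
        FractionRing (MvPolynomial (Fin m) k))) := by
  obtain ⟨φ, hφ, hcompat⟩ := exists_equivariant_algHom hodd hprod hind hgen hσ hτ hind' hgen' hρ'
  let : Algebra L L' := φ.toRingHom.toAlgebra
  have : IsScalarTower k L L' := IsScalarTower.of_algHom φ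
  obtain ⟨w, hw, hindw, hgenw⟩ := exists_invariant_generators hn hodd hind hgen hind' hgen' hρ'
    hφ hcompat
  have hinj : Function.Injective ρ' := (injective_iff_map_eq_one ρ').mpr fun g hg =>
    eq_one_of_fixes_quotientRatio hn hodd hind' hgen' hρ' g fun i => by
      rw [hg, AlgEquiv.one_apply]
  obtain ⟨e⟩ := nonempty_algEquiv_fixedField ρ ρ' hcompat hinj w hw hindw hgenw
  exact stably_rational_iff_of_algEquiv_fractionRing e
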